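/- Let X be a finite list of vectors in ℤ^n whose ℝ-linear span is all of ℝ^n. For p ∈ (ℂ*)^n let X_p be the sublist of those χ ∈ X with χ(p) = 1, and let C₀(X) = {p ∈ (ℂ*)^n : the ℝ-linear span of X_p is all of ℝ^n}. Then C₀(X) is a finite set, and M_X(1,y) = Σ_{p ∈ C₀(X)} T_{X_p}(1,y) as polynomials in y. -/

import Mathlib

/-- The rank of a sublist `A` of the list `X` of integer vectors. -/
noncomputable def rnk {n : ℕ} {ι : Type} [Fintype ι] (X : ι → Fin n → ℤ) (A : Finset ι) : ℕ :=
  Module.finrank ℝ (Submodule.span ℝ ((fun i (j : Fin n) => (X i j : ℝ)) '' ↑A))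

/-- The multiplicity of a sublist `A`: the cardinality of the torsion subgroup of
`ℤ^n / ⟨A⟩`, i.e. the index `[Λ_A : ⟨A⟩]`. -/
noncomputable def mult {n : ℕ} {ι : Type} [Fintype ι] (X : ι → Fin n → ℤ) (A : Finset ι) : ℕ :=
  Nat.card (Submodule.torsion ℤ ((Fin n → ℤ) ⧸ Submodule.span ℤ (X '' ↑A)))

/-- The multiplicity Tutte polynomial `M_X(x,y)`, as a real-valued function. -/
noncomputable def Mpoly {n : ℕ} {ι : Type} [Fintype ι] (X : ι → Fin n → ℤ) (x y : ℝ) : ℝ :=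
  ∑ A : Finset ι, (mult X A : ℝ) * (x - 1) ^ (rnk X Finset.univ - rnk X A) *
    (y - 1) ^ (A.card - rnk X A)

/-- The (ordinary) Tutte polynomial `T_Y(x,y)` of a list of integer vectors, as a real-valued
function. -/
noncomputable def Tpoly {n : ℕ} {ι : Type} [Fintype ι] (v : ι → Fin n → ℤ) (x y : ℝ) : ℝ :=
  ∑ A : Finset ι, (x - 1) ^ (rnk v Finset.univ - rnk v A) * (y - 1) ^ (A.card - rnk v A)

/-- The set `C₀(X)` of points of the toric arrangement: points `p ∈ (ℂ*)^n` such that the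
sublist `X_p = {χ ∈ X : χ(p) = 1}` spans `ℝ^n`, where `χ(p) = Π_i p_i^{χ_i}`. -/
def points {n N : ℕ} (X : Fin N → Fin n → ℤ) : Set (Fin n → ℂˣ) :=
  {p | Submodule.span ℝ
    ((fun i (j : Fin n) => (X i j : ℝ)) '' {i | ∏ j, p j ^ (X i j) = 1}) = ⊤}

/-- The Tutte polynomial of the sublist `X_p` of characters of `X` vanishing at `p`. -/
noncomputable def TpointPoly {n N : ℕ} (X : Fin N → Fin n → ℤ) (p : Fin n → ℂˣ)
    (x y : ℝ) : ℝ :=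
  letI : Fintype {i : Fin N // ∏ j, p j ^ (X i j) = 1} := Fintype.ofFinite _
  Tpoly (fun i : {i : Fin N // ∏ j, p j ^ (X i j) = 1} => X i.1) x y

/-- The points of the torus at which all characters in `A` take the value `1`. -/
def commonKernel {n N : ℕ} (X : Fin N → Fin n → ℤ) (A : Finset (Fin N)) : Set (Fin n → ℂˣ) :=
  {p | ∀ i ∈ A, ∏ j, p j ^ (X i j) = 1}

lemma rnk_le {n : ℕ} {ι : Type} [Fintype ι] (X : ι → Fin n → ℤ) (A : Finset ι) :
    rnk X A ≤ n := by
  simpa [rnk] using Submodule.finrank_le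
    (Submodule.span ℝ ((fun i (j : Fin n) => (X i j : ℝ)) '' ↑A))

lemma rnk_eq_iff {n : ℕ} {ι : Type} [Fintype ι] (X : ι → Fin n → ℤ) (A : Finset ι) :
    rnk X A = n ↔
      Submodule.span ℝ ((fun i (j : Fin n) => (X i j : ℝ)) '' (A : Set ι)) = ⊤ := by
  constructor
  · intro h
    apply Submodule.eq_top_of_finrank_eq
    simpa [rnk] using h
  · intro h
    rw [rnk, h, finrank_top, Module.finrank_fin_fun]

/-- A sublist spanning `ℝ^n` generates a subgroup of `ℤ^n` with torsion quotient. -/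
lemma torsion_quotient_eq_top {n : ℕ} {ι : Type} [Fintype ι] (X : ι → Fin n → ℤ) (A : Finset ι)
    (h : rnk X A = n) :
    Submodule.torsion ℤ ((Fin n → ℤ) ⧸ Submodule.span ℤ (X '' ↑A)) = ⊤ := by
  rw [rnk_eq_iff] at h
  set S := Submodule.span ℤ (X '' (A : Set ι))
  have key : ∀ f : ((Fin n → ℤ) ⧸ S) →ₗ[ℤ] ℤ, f = 0 := by
    intro f
    let g : (Fin n → ℝ) →ₗ[ℝ] ℝ :=
      (Pi.basisFun ℝ (Fin n)).constr ℝ (fun j => ((f (S.mkQ (Pi.single j 1)) : ℤ) : ℝ))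
    have hg : ∀ v : Fin n → ℤ, g (fun j => (v j : ℝ)) = ((f (S.mkQ v) : ℤ) : ℝ) := by
      intro v
      have hv : v = ∑ j, v j • (Pi.single j 1 : Fin n → ℤ) := pi_eq_sum_univ' v
      conv_rhs => rw [hv]
      simp only [g, Module.Basis.constr_apply_fintype, map_sum, map_smul]
      simp
    have hg0 : g = 0 := by
      apply LinearMap.ext_on h
      rintro _ ⟨i, hi, rfl⟩
      have : S.mkQ (X i) = 0 := by
        simpa using Submodule.subset_span (Set.mem_image_of_mem X hi)
      simp [hg, this]
    ext v
    have := hg (Pi.single v 1)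
    rw [hg0] at this
    simpa using this.symm
  rw [eq_top_iff]
  intro q _
  rw [← Submodule.Quotient.mk_eq_zero, ← Module.forall_dual_apply_eq_zero_iff ℤ]
  intro φ
  exact LinearMap.congr_fun (key (φ ∘ₗ Submodule.mkQ _)) q

lemma finite_quotient {n : ℕ} {ι : Type} [Fintype ι] (X : ι → Fin n → ℤ) (A : Finset ι)
    (h : rnk X A = n) : Finite ((Fin n → ℤ) ⧸ Submodule.span ℤ (X '' (A : Set ι))) := by
  apply Module.finite_of_fg_torsion
  exact (Submodule.isTorsion'_iff_torsion'_eq_top _).2 (torsion_quotient_eq_top X A h)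

lemma mult_eq_card_quotient {n : ℕ} {ι : Type} [Fintype ι] (X : ι → Fin n → ℤ) (A : Finset ι)
    (h : rnk X A = n) :
    mult X A = Nat.card ((Fin n → ℤ) ⧸ Submodule.span ℤ (X '' (A : Set ι))) := by
  rw [mult, torsion_quotient_eq_top X A h]
  exact Nat.card_congr Submodule.topEquiv.toEquiv

/-- The homomorphism `ℤ^n → ℂˣ`, `v ↦ ∏ p_j ^ v_j`, written additively. -/
def evalChar {n : ℕ} (p : Fin n → ℂˣ) : (Fin n → ℤ) →ₗ[ℤ] Additive ℂˣ :=
  Fintype.linearCombination ℤ (fun j => Additive.ofMul (p j))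

lemma evalChar_apply {n : ℕ} (p : Fin n → ℂˣ) (v : Fin n → ℤ) :
    evalChar p v = Additive.ofMul (∏ j, p j ^ v j) := by
  simp [evalChar, Fintype.linearCombination_apply, ofMul_prod]

/-- Points of the common kernel of `A` are the characters of `ℤ^n / ⟨A⟩`. -/
noncomputable def commonKernelEquiv {n N : ℕ} (X : Fin N → Fin n → ℤ) (A : Finset (Fin N)) :
    commonKernel X A ≃
      (((Fin n → ℤ) ⧸ Submodule.span ℤ (X '' (A : Set (Fin N)))) →ₗ[ℤ] Additive ℂˣ) where
  toFun p := Submodule.liftQ _ (evalChar p.1) <| by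
    rw [Submodule.span_le]
    rintro _ ⟨i, hi, rfl⟩
    have := p.2 i hi
    simp [evalChar_apply, this]
  invFun f := ⟨fun j => (f (Submodule.Quotient.mk (Pi.single j 1))).toMul, by
    intro i hi
    have hx : X i = ∑ j, X i j • (Pi.single j 1 : Fin n → ℤ) := pi_eq_sum_univ' (X i)
    have h0 : f (Submodule.mkQ _ (X i)) = 0 := by
      have : Submodule.mkQ (Submodule.span ℤ (X '' (A : Set (Fin N)))) (X i) = 0 := by
        simpa using Submodule.subset_span (Set.mem_image_of_mem X hi)
      rw [this, map_zero]
    rw [hx] at h0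
    simp only [map_sum, map_smul] at h0
    simpa [toMul_sum] using congrArg Additive.toMul h0⟩
  left_inv p := by
    ext j
    simp [evalChar]
  right_inv f := by
    ext j
    simp [evalChar]

lemma finite_commonKernel_and_card {n N : ℕ} (X : Fin N → Fin n → ℤ) (A : Finset (Fin N))
    (h : rnk X A = n) :
    (commonKernel X A).Finite ∧ (commonKernel X A).ncard = mult X A := by
  have := finite_quotient X A h
  let Q := (Fin n → ℤ) ⧸ Submodule.span ℤ (X '' (A : Set (Fin N)))
  let e : commonKernel X A ≃ (Multiplicative Q →* ℂˣ) :=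
    (commonKernelEquiv X A).trans
      ((addMonoidHomLequivInt ℤ).symm.toEquiv.trans AddMonoidHom.toMultiplicativeLeft)
  have hc : Nat.card (commonKernel X A) = mult X A := by
    rw [Nat.card_congr e, mult_eq_card_quotient X A h,
      CommGroup.card_monoidHom_of_hasEnoughRootsOfUnity]
    rfl
  refine ⟨?_, hc⟩
  rw [← Set.finite_coe_iff]
  apply Nat.finite_of_card_ne_zero
  rw [hc, mult_eq_card_quotient X A h]
  exact Nat.card_pos.ne'

lemma mem_points_iff {n N : ℕ} (X : Fin N → Fin n → ℤ) (p : Fin n → ℂˣ) :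
    p ∈ points X ↔ ∃ A : Finset (Fin N), rnk X A = n ∧ p ∈ commonKernel X A := by
  classical
  constructor
  · intro hp
    refine ⟨Finset.univ.filter (fun i => ∏ j, p j ^ (X i j) = 1), ?_, ?_⟩
    · rw [rnk_eq_iff]
      simpa [points] using hp
    · intro i hi
      simpa using hi
  · rintro ⟨A, hA, hp⟩
    rw [rnk_eq_iff] at hA
    exact eq_top_mono (Submodule.span_mono (Set.image_mono hp)) hA

lemma finite_points {n N : ℕ} (X : Fin N → Fin n → ℤ) : (points X).Finite := by
  have : points X = ⋃ A ∈ {A : Finset (Fin N) | rnk X A = n}, commonKernel X A := by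
    ext p
    simp [mem_points_iff]
  rw [this]
  exact (Set.toFinite _).biUnion fun A hA => (finite_commonKernel_and_card X A hA).1

lemma zero_pow_rank_sub {n : ℕ} {ι : Type} [Fintype ι] (X : ι → Fin n → ℤ) (A : Finset ι) :
    (1 - 1 : ℝ) ^ (n - rnk X A) = if rnk X A = n then 1 else 0 := by
  have := rnk_le X A
  rw [sub_self, zero_pow_eq]
  congr 1
  simp only [eq_iff_iff]
  omega

lemma rnk_map_subtype {n : ℕ} {ι : Type} [Fintype ι] (X : ι → Fin n → ℤ) (P : ι → Prop)
    [Fintype {i // P i}] (A : Finset {i // P i}) :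
    rnk X (A.map (Function.Embedding.subtype P)) = rnk (fun i : {i // P i} => X i.1) A := by
  rw [rnk, rnk, Finset.coe_map, Set.image_image]
  rfl

open Classical in
lemma Tpoly_one_left {n : ℕ} {ι : Type} [Fintype ι] (X : ι → Fin n → ℤ)
    (hX : rnk X Finset.univ = n) (y : ℝ) :
    Tpoly X 1 y = ∑ A : Finset ι with rnk X A = n, (y - 1) ^ (A.card - n) := by
  rw [Tpoly, Finset.sum_filter]
  refine Finset.sum_congr rfl fun A _ => ?_
  rw [hX, zero_pow_rank_sub]
  split_ifs with h <;> simp [h]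

open Classical in
lemma Mpoly_one_left {n : ℕ} {ι : Type} [Fintype ι] (X : ι → Fin n → ℤ)
    (hX : rnk X Finset.univ = n) (y : ℝ) :
    Mpoly X 1 y =
      ∑ A : Finset ι with rnk X A = n, (mult X A : ℝ) * (y - 1) ^ (A.card - n) := by
  rw [Mpoly, Finset.sum_filter]
  refine Finset.sum_congr rfl fun A _ => ?_
  rw [hX, zero_pow_rank_sub]
  split_ifs with h <;> simp [h]

open Classical in
lemma TpointPoly_one_left {n N : ℕ} (X : Fin N → Fin n → ℤ) (p : Fin n → ℂˣ)
    (hp : p ∈ points X) (y : ℝ) :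
    TpointPoly X p 1 y = ∑ A : Finset (Fin N) with rnk X A = n,
      if p ∈ commonKernel X A then (y - 1) ^ (A.card - n) else 0 := by
  let P : Fin N → Prop := fun i => ∏ j, p j ^ (X i j) = 1
  let _ : Fintype {i // P i} := Fintype.ofFinite _
  have hu : rnk (fun i : {i // P i} => X i.1) Finset.univ = n := by
    rw [rnk_eq_iff]
    convert hp using 1
    simp only [points, Set.mem_ofPred_eq, Finset.coe_univ, Set.image_univ]
    rw [← Subtype.range_coe_subtype, ← Set.range_comp]
    rfl
  have hT : TpointPoly X p 1 y = Tpoly (fun i : {i // P i} => X i.1) 1 y := rfl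
  rw [hT, Tpoly_one_left _ hu, ← Finset.sum_filter]
  refine Finset.sum_nbij' (fun A => A.map (Function.Embedding.subtype P))
    (fun A => A.subtype P) ?_ ?_ ?_ ?_ ?_
  · intro A hA
    simp only [Finset.mem_filter, Finset.mem_univ, true_and] at hA ⊢
    refine ⟨by rw [rnk_map_subtype, hA], fun i hi => ?_⟩
    exact Finset.property_of_mem_map_subtype A hi
  · intro A hA
    simp only [Finset.mem_filter, Finset.mem_univ, true_and] at hA ⊢
    rw [← rnk_map_subtype, Finset.subtype_map_of_mem hA.2, hA.1]
  · intro A _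
    exact Finset.map_injective (Function.Embedding.subtype P)
      (Finset.subtype_map_of_mem fun i hi => Finset.property_of_mem_map_subtype A hi)
  · intro A hA
    simp only [Finset.mem_filter] at hA
    exact Finset.subtype_map_of_mem hA.2
  · intro A _
    simp

/-- `C₀(X)` is finite and `M_X(1,y) = Σ_{p ∈ C₀(X)} T_{X_p}(1,y)`. -/
theorem stmt11 {n N : ℕ} (X : Fin N → Fin n → ℤ)
    (hspan : Submodule.span ℝ (Set.range (fun i (j : Fin n) => (X i j : ℝ))) = ⊤) :
    (points X).Finite ∧
      ∀ y : ℝ, Mpoly X 1 y = ∑ᶠ p ∈ points X, TpointPoly X p 1 y := by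
  classical
  have hfin := finite_points X
  refine ⟨hfin, fun y => ?_⟩
  have hX : rnk X Finset.univ = n := by
    rw [rnk_eq_iff]
    simpa using hspan
  rw [finsum_mem_eq_finite_toFinset_sum _ hfin, Mpoly_one_left X hX,
    Finset.sum_congr rfl fun p hp => TpointPoly_one_left X p (hfin.mem_toFinset.1 hp) y,
    Finset.sum_comm]
  refine Finset.sum_congr rfl fun A hA => ?_
  have hA' : rnk X A = n := by simpa using hA
  have hcard : mult X A = (hfin.toFinset.filter (· ∈ commonKernel X A)).card := by
    rw [← (finite_commonKernel_and_card X A hA').2, ← Set.ncard_coe_finset]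
    congr 1
    ext p
    simpa using fun h => (mem_points_iff X p).2 ⟨A, hA', h⟩
  rw [← Finset.sum_filter, Finset.sum_const, nsmul_eq_mul, hcard]
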